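/- Let c = 1/2 + 1/(2√2). There do not exist a measurable space Λ, probability measures μ₀ and μ₁ on Λ, and measurable subsets Ω₀ and Ω₁ of Λ with (Ω₀ ∩ Ω₁ = ∅ or Ω₀ = Ω₁), such that μ₀(Ω₀) = c, μ₀(Ω₁) = c, μ₁(Ω₀) = c, and μ₁(Ω₁) = 1 − c. -/

import Mathlib

open MeasureTheory

/-- No-go consequence of the main theorem: no ontological model satisfying both
no overlap and strong duality can reproduce the quantum statistics
`p(0|0,0) = p(0|1,0) = p(0|0,1) = c` and `p(0|1,1) = 1 − c` with `c = 1/2 + 1/(2√2)`. -/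
theorem no_universally_classical_model :
    ¬ ∃ (Λ : Type) (_ : MeasurableSpace Λ) (μ₀ μ₁ : Measure Λ),
      IsProbabilityMeasure μ₀ ∧ IsProbabilityMeasure μ₁ ∧
      ∃ (Ω₀ Ω₁ : Set Λ), MeasurableSet Ω₀ ∧ MeasurableSet Ω₁ ∧
        (Ω₀ ∩ Ω₁ = ∅ ∨ Ω₀ = Ω₁) ∧
        (μ₀ Ω₀).toReal = 1 / 2 + 1 / (2 * Real.sqrt 2) ∧
        (μ₀ Ω₁).toReal = 1 / 2 + 1 / (2 * Real.sqrt 2) ∧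
        (μ₁ Ω₀).toReal = 1 / 2 + 1 / (2 * Real.sqrt 2) ∧
        (μ₁ Ω₁).toReal = 1 - (1 / 2 + 1 / (2 * Real.sqrt 2)) := by
  rintro ⟨Λ, _, μ₀, μ₁, _, _, Ω₀, Ω₁, -, hΩ₁, hΩ, h₀₀, h₀₁, h₁₀, h₁₁⟩
  have hpos : 0 < 1 / (2 * Real.sqrt 2) := by positivity
  rcases hΩ with hdisj | rfl
  · have hunion : μ₀.real (Ω₀ ∪ Ω₁) = μ₀.real Ω₀ + μ₀.real Ω₁ :=
      measureReal_union (Set.disjoint_iff_inter_eq_empty.mpr hdisj) hΩ₁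
    have hle : μ₀.real (Ω₀ ∪ Ω₁) ≤ 1 := measureReal_le_one
    simp only [Measure.real] at hunion hle
    linarith
  · linarith
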